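/- For every natural number n ≥ 1, the n-th symmetric product F_n(𝔈_c) of complete Erdős space, endowed with the Vietoris topology, is homeomorphic to complete Erdős space 𝔈_c. -/

import Mathlib

open Set Topology

noncomputable section

/-- The Vietoris topology on the powerset of `X` induced by a topology `τ`,
generated by the sets `{F | F ⊆ U}` and `{F | F ∩ U ≠ ∅}` for `U` a nonempty `τ`-open set. -/
def VietorisTop {X : Type*} (τ : TopologicalSpace X) : TopologicalSpace (Set X) :=
  TopologicalSpace.generateFrom
    ({S : Set (Set X) | ∃ U : Set X, IsOpen[τ] U ∧ U.Nonempty ∧ S = {F : Set X | F ⊆ U}} ∪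
     {S : Set (Set X) | ∃ U : Set X, IsOpen[τ] U ∧ U.Nonempty ∧ S = {F : Set X | (F ∩ U).Nonempty}})

/-- The hyperspace `K(X)` of nonempty compact subsets of `X`. -/
def HypK (X : Type*) [TopologicalSpace X] : Type _ := {F : Set X // F.Nonempty ∧ IsCompact F}

/-- `K(X)` carries the Vietoris topology. -/
instance (X : Type*) [τ : TopologicalSpace X] : TopologicalSpace (HypK X) :=
  (VietorisTop τ).induced Subtype.val

/-- The `n`-th symmetric product `F_n(X)`: nonempty subsets of `X` with at most `n` points. -/
def HypFn (n : ℕ) (X : Type*) [TopologicalSpace X] : Type _ :=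
  {F : Set X // F.Nonempty ∧ F.Finite ∧ F.ncard ≤ n}

/-- `F_n(X)` carries the Vietoris topology. -/
instance (n : ℕ) (X : Type*) [τ : TopologicalSpace X] : TopologicalSpace (HypFn n X) :=
  (VietorisTop τ).induced Subtype.val

/-- The hyperspace `F(X)` of nonempty finite subsets of `X`. -/
def HypFin (X : Type*) [TopologicalSpace X] : Type _ := {F : Set X // F.Nonempty ∧ F.Finite}

/-- `F(X)` carries the Vietoris topology. -/
instance (X : Type*) [τ : TopologicalSpace X] : TopologicalSpace (HypFin X) :=
  (VietorisTop τ).induced Subtype.val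

/-- A space is almost zero-dimensional if every point has a neighborhood basis consisting of
sets each of which is an intersection of clopen sets. -/
def IsAZD (X : Type*) [TopologicalSpace X] : Prop :=
  ∀ x : X, ∀ U ∈ nhds x, ∃ V ∈ nhds x, V ⊆ U ∧
    ∃ C : Set (Set X), (∀ c ∈ C, IsClopen c) ∧ V = ⋂₀ C

/-- `X` is `𝒜`-cohesive: every point has a neighborhood containing no nonempty proper
subset of an element `A ∈ 𝒜` that is clopen in the subspace topology of `A`. -/
def CohesiveWrt (X : Type*) [TopologicalSpace X] (𝒜 : Set (Set X)) : Prop :=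
  ∀ x : X, ∃ U ∈ nhds x, ∀ A ∈ 𝒜, ∀ C : Set X,
    C ⊆ U → C ⊆ A → C.Nonempty → C ≠ A → ¬ IsClopen {y : A | (y : X) ∈ C}

/-- A space is cohesive if it is `{X}`-cohesive. -/
def Cohesive (X : Type*) [TopologicalSpace X] : Prop := CohesiveWrt X {Set.univ}

/-- Erdős space: the rational points of the Hilbert space `ℓ²`. -/
def ErdosSpace : Type :=
  {x : lp (fun _ : ℕ => ℝ) 2 // ∀ n : ℕ, ∃ q : ℚ, x.val n = (q : ℝ)}

instance : TopologicalSpace ErdosSpace := by unfold ErdosSpace; infer_instance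

/-- Complete Erdős space: points of `ℓ²` all of whose coordinates lie in `{0} ∪ {1/m : m ≥ 1}`. -/
def CompleteErdosSpace : Type :=
  {x : lp (fun _ : ℕ => ℝ) 2 // ∀ n : ℕ, x.val n = 0 ∨ ∃ m : ℕ, 0 < m ∧ x.val n = 1 / (m : ℝ)}

instance : TopologicalSpace CompleteErdosSpace := by unfold CompleteErdosSpace; infer_instance

open Filter MeasureTheory

/-- The filter of neighborhoods of `x` in the topology with basis `𝒜`. -/
def coarseNhds {X : Type*} (𝒜 : Set (Set X)) (x : X) : Filter X :=
  ⨅ a ∈ {a | a ∈ 𝒜 ∧ x ∈ a}, 𝓟 a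

/-- A Lelek structure on `X`: a countable separating algebra `𝒜` of subsets, regarded as a basis of
a coarse zero-dimensional topology, and a function `N` with compact sublevel sets whose values on
each member of `𝒜` are dense above any of them. -/
structure IsLelek {X : Type*} (𝒜 : Set (Set X)) (N : X → ℝ) : Prop where
  countable : 𝒜.Countable
  algebra : IsSetAlgebra 𝒜
  separates : ∀ x y, x ≠ y → ∃ a ∈ 𝒜, x ∈ a ∧ y ∉ a
  nonneg : ∀ x, 0 ≤ N x
  compact : ∀ U : Ultrafilter X, (∃ r, ∀ᶠ x in (U : Filter X), N x ≤ r) →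
    ∃ x, (∀ a ∈ 𝒜, x ∈ a → a ∈ U) ∧ ∀ r, (∀ᶠ y in (U : Filter X), N y ≤ r) → N x ≤ r
  dense : ∀ a ∈ 𝒜, ∀ x ∈ a, ∀ r s, N x ≤ r → r < s → ∃ y ∈ a, r < N y ∧ N y < s

section Coarse

variable {X : Type*} {𝒜 : Set (Set X)} {N : X → ℝ}

theorem mem_coarseNhds (h : IsSetAlgebra 𝒜) {x : X} {s : Set X} :
    s ∈ coarseNhds 𝒜 x ↔ ∃ a ∈ 𝒜, x ∈ a ∧ a ⊆ s := by
  rw [coarseNhds, mem_biInf_of_directed]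
  · simp [and_assoc]
  · rintro a ⟨ha, hxa⟩ b ⟨hb, hxb⟩
    refine ⟨a ∩ b, ⟨h.inter_mem ha hb, hxa, hxb⟩, ?_, ?_⟩ <;> simp [Order.Preimage]
  · exact ⟨univ, h.univ_mem, mem_univ x⟩

theorem mem_coarseNhds_of_mem {x : X} {a : Set X} (ha : a ∈ 𝒜) (hx : x ∈ a) :
    a ∈ coarseNhds 𝒜 x :=
  mem_iInf_of_mem a (mem_iInf_of_mem ⟨ha, hx⟩ (mem_principal_self a))

theorem eventually_mem_iff_coarseNhds (h : IsSetAlgebra 𝒜) {a : Set X} (ha : a ∈ 𝒜) (x : X) :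
    ∀ᶠ y in coarseNhds 𝒜 x, (y ∈ a ↔ x ∈ a) := by
  by_cases hx : x ∈ a
  · filter_upwards [mem_coarseNhds_of_mem ha hx] with y hy
    simp [hy, hx]
  · filter_upwards [mem_coarseNhds_of_mem (h.compl_mem ha) hx] with y hy
    simp only [hx, iff_false]
    exact hy

namespace IsLelek

/-- The function `N` is lower semicontinuous in the coarse topology. -/
theorem eventually_lt (h : IsLelek 𝒜 N) {x : X} {t : ℝ} (ht : t < N x) :
    ∀ᶠ y in coarseNhds 𝒜 x, t < N y := by
  by_contra hcon
  have hfreq : ∃ᶠ y in coarseNhds 𝒜 x, N y ≤ t :=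
    (not_eventually.1 hcon).mono fun y hy => not_lt.1 hy
  have hne : (coarseNhds 𝒜 x ⊓ 𝓟 {y | N y ≤ t}).NeBot :=
    frequently_mem_iff_neBot.1 hfreq
  set U := Ultrafilter.of (coarseNhds 𝒜 x ⊓ 𝓟 {y | N y ≤ t})
  have hU : (U : Filter X) ≤ coarseNhds 𝒜 x ⊓ 𝓟 {y | N y ≤ t} := Ultrafilter.of_le _
  have hUt : ∀ᶠ y in (U : Filter X), N y ≤ t := hU (mem_inf_of_right (mem_principal_self _))
  obtain ⟨z, hz, hzt⟩ := h.compact U ⟨t, hUt⟩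
  have hzx : x ≠ z := by
    rintro rfl
    exact absurd (hzt t hUt) (not_le.2 ht)
  obtain ⟨a, ha, hxa, hza⟩ := h.separates x z hzx
  exact Ultrafilter.compl_mem_iff_notMem.1 (hz _ (h.algebra.compl_mem ha) hza)
    (hU (mem_inf_of_left (mem_coarseNhds_of_mem ha hxa)))

theorem exists_isMinOn (h : IsLelek 𝒜 N) {a : Set X} (ha : a ∈ 𝒜) (hne : a.Nonempty) :
    ∃ p ∈ a, ∀ x ∈ a, N p ≤ N x := by
  have hbdd : BddBelow (N '' a) := ⟨0, by rintro _ ⟨x, -, rfl⟩; exact h.nonneg x⟩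
  have hex : ∀ j : ℕ, ∃ x ∈ a, N x < sInf (N '' a) + 1 / (j + 1) := fun j => by
    obtain ⟨_, ⟨x, hx, rfl⟩, hlt⟩ := exists_lt_of_csInf_lt (hne.image N)
      (lt_add_of_pos_right (sInf (N '' a)) (Nat.one_div_pos_of_nat (n := j)))
    exact ⟨x, hx, hlt⟩
  choose u hua hu using hex
  have hev : ∀ j : ℕ, ∀ᶠ x in ((hyperfilter ℕ).map u : Filter X),
      N x ≤ sInf (N '' a) + 1 / (j + 1) := fun j => by
    rw [Ultrafilter.coe_map, eventually_map]
    refine Nat.hyperfilter_le_atTop ?_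
    filter_upwards [eventually_ge_atTop j] with i hi
    refine (hu i).le.trans ?_
    gcongr
  obtain ⟨p, hp, hpr⟩ := h.compact ((hyperfilter ℕ).map u) ⟨_, hev 0⟩
  have hpa : p ∈ a := by
    by_contra hpa
    have := hp _ (h.algebra.compl_mem ha) hpa
    rw [Ultrafilter.mem_map] at this
    have hempty : u ⁻¹' aᶜ = ∅ := by ext i; simp [hua i]
    rw [hempty] at this
    exact (hyperfilter ℕ).empty_notMem this
  refine ⟨p, hpa, fun x hx => le_trans ?_ (csInf_le hbdd ⟨x, hx, rfl⟩)⟩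
  have hlim : Tendsto (fun j : ℕ => sInf (N '' a) + 1 / ((j : ℝ) + 1)) atTop
      (𝓝 (sInf (N '' a) + 0)) := tendsto_const_nhds.add tendsto_one_div_add_atTop_nhds_zero_nat
  rw [add_zero] at hlim
  exact ge_of_tendsto' hlim fun j => hpr _ (hev j)

/-- Every member of the algebra `𝒜` can be split, in such a way that a given `a ∈ 𝒜` is decided. -/
theorem exists_split (h : IsLelek 𝒜 N) {P a : Set X} (hP : P ∈ 𝒜) (ha : a ∈ 𝒜) {p : X}
    (hp : p ∈ P) : ∃ c ∈ 𝒜, p ∈ c ∧ (P \ c).Nonempty ∧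
      (P ∩ c ⊆ a ∨ Disjoint (P ∩ c) a) ∧ (P \ c ⊆ a ∨ Disjoint (P \ c) a) := by
  by_cases hsub : P ⊆ a ∨ Disjoint P a
  · obtain ⟨y, hyP, hy, -⟩ := h.dense P hP p hp (N p) (N p + 1) le_rfl (by linarith)
    obtain ⟨c, hc, hpc, hyc⟩ := h.separates p y (by rintro rfl; exact lt_irrefl _ hy)
    refine ⟨c, hc, hpc, ⟨y, hyP, hyc⟩, ?_, ?_⟩
    · exact hsub.imp inter_subset_left.trans (Disjoint.mono_left inter_subset_left)
    · exact hsub.imp sdiff_subset.trans (Disjoint.mono_left sdiff_subset)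
  · rw [not_or, not_subset, not_disjoint_iff] at hsub
    obtain ⟨⟨x, hxP, hxa⟩, y, hyP, hya⟩ := hsub
    by_cases hpa : p ∈ a
    · exact ⟨a, ha, hpa, ⟨x, hxP, hxa⟩, .inl inter_subset_right, .inr disjoint_sdiff_left⟩
    · refine ⟨aᶜ, h.algebra.compl_mem ha, hpa, ⟨y, hyP, not_not.2 hya⟩, .inr ?_, .inl ?_⟩
      · exact disjoint_compl_left.mono_left inter_subset_right
      · exact fun z hz => not_not.1 hz.2

end IsLelek

end Coarse

/-- A matched pair of members of two algebras, with points minimizing the two functions. -/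
structure LelekNode {X Y : Type*} (𝒜 : Set (Set X)) (N : X → ℝ) (ℬ : Set (Set Y))
    (M : Y → ℝ) where
  P : Set X
  Q : Set Y
  p : X
  q : Y
  P_mem : P ∈ 𝒜
  Q_mem : Q ∈ ℬ
  p_mem : p ∈ P
  q_mem : q ∈ Q
  p_le : ∀ x ∈ P, N p ≤ N x
  q_le : ∀ y ∈ Q, M q ≤ M y

namespace LelekNode

variable {X Y : Type*} {𝒜 : Set (Set X)} {N : X → ℝ} {ℬ : Set (Set Y)} {M : Y → ℝ}

/-- The difference of the two minima. -/
def gap (n : LelekNode 𝒜 N ℬ M) : ℝ := M n.q - N n.p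

/-- The node with the two sides exchanged. -/
def swap (n : LelekNode 𝒜 N ℬ M) : LelekNode ℬ M 𝒜 N :=
  ⟨n.Q, n.P, n.q, n.p, n.Q_mem, n.P_mem, n.q_mem, n.p_mem, n.q_le, n.p_le⟩

/-- The family `c` partitions both sides of `n`, with gaps within `ε` of that of `n`. -/
structure Refines {ι : Type*} (n : LelekNode 𝒜 N ℬ M) (c : ι → LelekNode 𝒜 N ℬ M) (ε : ℝ) :
    Prop where
  P_iff : ∀ x, x ∈ n.P ↔ ∃ i, x ∈ (c i).P
  Q_iff : ∀ y, y ∈ n.Q ↔ ∃ i, y ∈ (c i).Q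
  P_inj : ∀ i j x, x ∈ (c i).P → x ∈ (c j).P → i = j
  Q_inj : ∀ i j y, y ∈ (c i).Q → y ∈ (c j).Q → i = j
  gap_le : ∀ i, |(c i).gap - n.gap| ≤ ε

theorem Refines.swap {ι : Type*} {n : LelekNode 𝒜 N ℬ M} {c : ι → LelekNode 𝒜 N ℬ M} {ε : ℝ}
    (h : n.Refines c ε) : n.swap.Refines (fun i => (c i).swap) ε :=
  ⟨h.Q_iff, h.P_iff, h.Q_inj, h.P_inj, fun i => by
    have hi := h.gap_le i
    rw [abs_sub_comm] at hi
    convert! hi using 2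
    simp only [gap, LelekNode.swap]
    ring⟩

theorem Refines.trans {ι κ : Type*} {n : LelekNode 𝒜 N ℬ M} {c : ι → LelekNode 𝒜 N ℬ M}
    {d : ι → κ → LelekNode 𝒜 N ℬ M} {ε δ : ℝ} (h : n.Refines c ε)
    (hd : ∀ i, (c i).Refines (d i) δ) :
    n.Refines (fun ij : ι × κ => d ij.1 ij.2) (ε + δ) where
  P_iff x := by simp only [h.P_iff, (hd _).P_iff, Prod.exists]
  Q_iff x := by simp only [h.Q_iff, (hd _).Q_iff, Prod.exists]
  P_inj := by
    rintro ⟨i, k⟩ ⟨j, l⟩ x hx hx'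
    obtain rfl := h.P_inj i j x (((hd i).P_iff x).2 ⟨k, hx⟩) (((hd j).P_iff x).2 ⟨l, hx'⟩)
    obtain rfl := (hd i).P_inj k l x hx hx'
    rfl
  Q_inj := by
    rintro ⟨i, k⟩ ⟨j, l⟩ x hx hx'
    obtain rfl := h.Q_inj i j x (((hd i).Q_iff x).2 ⟨k, hx⟩) (((hd j).Q_iff x).2 ⟨l, hx'⟩)
    obtain rfl := (hd i).Q_inj k l x hx hx'
    rfl
  gap_le ij := by
    have := abs_sub_le (d ij.1 ij.2).gap (c ij.1).gap n.gap
    linarith [h.gap_le ij.1, (hd ij.1).gap_le ij.2]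

theorem exists_refines (hX : IsLelek 𝒜 N) (hY : IsLelek ℬ M) (n : LelekNode 𝒜 N ℬ M)
    {a : Set X} (ha : a ∈ 𝒜) {ε : ℝ} (hε : 0 < ε) :
    ∃ c : Bool → LelekNode 𝒜 N ℬ M, n.Refines c ε ∧ ∀ i, (c i).P ⊆ a ∨ Disjoint (c i).P a := by
  obtain ⟨c, hc, hpc, hne, hc₁, hc₂⟩ := hX.exists_split n.P_mem ha n.p_mem
  have hPc := hX.algebra.sdiff_mem n.P_mem hc
  obtain ⟨p', hp', hp'le⟩ := hX.exists_isMinOn hPc hne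
  have hpp' : N n.p ≤ N p' := n.p_le p' hp'.1
  obtain ⟨y, hyQ, hvy, hyv⟩ := hY.dense n.Q n.Q_mem n.q n.q_mem (M n.q + (N p' - N n.p))
    (M n.q + (N p' - N n.p) + ε) (by linarith) (by linarith)
  obtain ⟨b, hb, hyb, hbv⟩ := (mem_coarseNhds hY.algebra).1 (hY.eventually_lt hvy)
  have hqb : n.q ∉ b := fun hq => by
    have : M n.q + (N p' - N n.p) < M n.q := hbv hq
    linarith
  have hQb := hY.algebra.inter_mem n.Q_mem hb
  obtain ⟨q', hq', hq'le⟩ := hY.exists_isMinOn hQb ⟨y, hyQ, hyb⟩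
  have hvq' : M n.q + (N p' - N n.p) < M q' := hbv hq'.2
  have hq'y := hq'le y ⟨hyQ, hyb⟩
  let n₁ : LelekNode 𝒜 N ℬ M := ⟨n.P ∩ c, n.Q \ b, n.p, n.q, hX.algebra.inter_mem n.P_mem hc,
    hY.algebra.sdiff_mem n.Q_mem hb, ⟨n.p_mem, hpc⟩, ⟨n.q_mem, hqb⟩, fun x hx => n.p_le x hx.1,
    fun x hx => n.q_le x hx.1⟩
  let n₂ : LelekNode 𝒜 N ℬ M := ⟨n.P \ c, n.Q ∩ b, p', q', hPc, hQb, hp', hq', hp'le, hq'le⟩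
  refine ⟨fun i => bif i then n₁ else n₂, ⟨?_, ?_, ?_, ?_, ?_⟩, ?_⟩
  · intro x
    simp only [Bool.exists_bool, cond_true, cond_false, n₁, n₂, mem_inter_iff, Set.mem_sdiff]
    tauto
  · intro x
    simp only [Bool.exists_bool, cond_true, cond_false, n₁, n₂, mem_inter_iff, Set.mem_sdiff]
    tauto
  · rintro (_ | _) (_ | _) x <;> simp +contextual [n₁, n₂]
  · rintro (_ | _) (_ | _) x <;> simp +contextual [n₁, n₂]
  · rintro (_ | _)
    · simp only [cond_false, n₂, gap]
      rw [abs_le]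
      constructor <;> linarith
    · simpa [n₁, gap] using hε.le
  · rintro (_ | _)
    · exact hc₂
    · exact hc₁

theorem exists_refines_both (hX : IsLelek 𝒜 N) (hY : IsLelek ℬ M) (n : LelekNode 𝒜 N ℬ M)
    {a : Set X} (ha : a ∈ 𝒜) {b : Set Y} (hb : b ∈ ℬ) {ε : ℝ} (hε : 0 < ε) :
    ∃ c : Bool × Bool → LelekNode 𝒜 N ℬ M, n.Refines c ε ∧
      ∀ i, ((c i).P ⊆ a ∨ Disjoint (c i).P a) ∧ ((c i).Q ⊆ b ∨ Disjoint (c i).Q b) := by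
  obtain ⟨c, hc, hca⟩ := exists_refines hX hY n ha (half_pos hε)
  choose d hd hdb using fun i => exists_refines hY hX (c i).swap hb (half_pos hε)
  have href : ∀ i, (c i).Refines (fun j => (d i j).swap) (ε / 2) := fun i => (hd i).swap
  refine ⟨_, add_halves ε ▸ hc.trans href, fun ij => ⟨?_, hdb ij.1 ij.2⟩⟩
  have hsub : ((d ij.1 ij.2).swap).P ⊆ (c ij.1).P := fun x hx =>
    ((href ij.1).P_iff x).2 ⟨ij.2, hx⟩
  exact (hca ij.1).imp hsub.trans (Disjoint.mono_left hsub)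

end LelekNode

/-- A tree of members of `𝒜`, each level being a partition, which decides every member of `𝒜`,
together with points minimizing `N`. -/
structure IsLelekScheme {X ι : Type*} (𝒜 : Set (Set X)) (N : X → ℝ) (P : List ι → Set X)
    (p : List ι → X) : Prop where
  root : P [] = univ
  mem_algebra : ∀ l, P l ∈ 𝒜
  mem_iff : ∀ l x, x ∈ P l ↔ ∃ i, x ∈ P (i :: l)
  inj : ∀ l i j x, x ∈ P (i :: l) → x ∈ P (j :: l) → i = j
  min_mem : ∀ l, p l ∈ P l
  min_le : ∀ l, ∀ x ∈ P l, N (p l) ≤ N x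
  decides : ∀ a ∈ 𝒜, ∃ k, ∀ l, k ≤ l.length → P l ⊆ a ∨ Disjoint (P l) a

namespace IsLelekScheme

variable {X Y ι : Type*} {𝒜 : Set (Set X)} {N : X → ℝ} {ℬ : Set (Set Y)} {M : Y → ℝ}
  {P : List ι → Set X} {p : List ι → X} {Q : List ι → Set Y} {q : List ι → Y}

theorem exists_branch (h : IsLelekScheme 𝒜 N P p) (x : X) : ∃ b : ℕ → List ι,
    (∀ k, (b k).length = k) ∧ (∀ k, x ∈ P (b k)) ∧ ∀ k, ∃ i, b (k + 1) = i :: b k := by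
  choose f hf using fun l : {l // x ∈ P l} => (h.mem_iff l.1 x).1 l.2
  let F : {l // x ∈ P l} → {l // x ∈ P l} := fun l => ⟨f l :: l.1, hf l⟩
  let r : {l // x ∈ P l} := ⟨[], h.root ▸ mem_univ x⟩
  have hsucc : ∀ k, (F^[k + 1] r).1 = f (F^[k] r) :: (F^[k] r).1 := fun k => by
    rw [Function.iterate_succ_apply']
  refine ⟨fun k => (F^[k] r).1, fun k => ?_, fun k => (F^[k] r).2, fun k => ⟨_, hsucc k⟩⟩
  induction k with
  | zero => rfl
  | succ k ih =>
    simp only at ih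
    simp only [hsucc, List.length_cons, ih]

theorem eq_of_mem (h : IsLelekScheme 𝒜 N P p) {x : X} : ∀ {l l' : List ι},
    l.length = l'.length → x ∈ P l → x ∈ P l' → l = l'
  | [], [], _, _, _ => rfl
  | i :: l, j :: l', hlen, hx, hx' => by
    obtain rfl := h.eq_of_mem (l := l) (l' := l') (by simpa using hlen)
      ((h.mem_iff l x).2 ⟨i, hx⟩) ((h.mem_iff l' x).2 ⟨j, hx'⟩)
    rw [h.inj l i j x hx hx']

theorem eq_of_forall_mem (h : IsLelekScheme 𝒜 N P p) (hX : IsLelek 𝒜 N) {x y : X}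
    (hxy : ∀ k, ∃ l, l.length = k ∧ x ∈ P l ∧ y ∈ P l) : x = y := by
  by_contra hne
  obtain ⟨a, ha, hxa, hya⟩ := hX.separates x y hne
  obtain ⟨k, hk⟩ := h.decides a ha
  obtain ⟨l, rfl, hxl, hyl⟩ := hxy k
  rcases hk l le_rfl with hl | hl
  · exact hya (hl hyl)
  · exact disjoint_left.1 hl hxl hxa

/-- Along the branch of `x`, the minima of `N` converge to `N x`. -/
theorem tendsto_min (h : IsLelekScheme 𝒜 N P p) (hX : IsLelek 𝒜 N) {x : X} {b : ℕ → List ι}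
    (hlen : ∀ k, (b k).length = k) (hb : ∀ k, x ∈ P (b k)) :
    Tendsto (fun k => N (p (b k))) atTop (𝓝 (N x)) := by
  refine tendsto_order.2 ⟨fun t ht => ?_, fun t ht => .of_forall fun k =>
    (h.min_le _ x (hb k)).trans_lt ht⟩
  obtain ⟨a, ha, hxa, hat⟩ := (mem_coarseNhds hX.algebra).1 (hX.eventually_lt ht)
  obtain ⟨k, hk⟩ := h.decides a ha
  filter_upwards [eventually_ge_atTop k] with j hj
  rcases hk (b j) (hj.trans_eq (hlen j).symm) with hl | hl
  · exact hat (hl (h.min_mem _))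
  · exact absurd hxa (disjoint_left.1 hl (hb j))

theorem abs_gap_sub_le
    (hgap : ∀ i l, |(M (q (i :: l)) - N (p (i :: l))) - (M (q l) - N (p l))| ≤
      1 / 2 / 2 ^ l.length)
    (h : IsLelekScheme 𝒜 N P p) (h' : IsLelekScheme ℬ M Q q)
    (hX : IsLelek 𝒜 N) (hY : IsLelek ℬ M) {x : X} {y : Y} (hxy : ∀ l, x ∈ P l → y ∈ Q l)
    {l : List ι} (hl : x ∈ P l) : |(M (q l) - N (p l)) - (M y - N x)| ≤ 1 / 2 ^ l.length := by
  obtain ⟨b, hlen, hb, hsucc⟩ := h.exists_branch x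
  have hlim := (h'.tendsto_min hY hlen fun k => hxy _ (hb k)).sub (h.tendsto_min hX hlen hb)
  have hdist : ∀ k, dist (M (q (b k)) - N (p (b k))) (M (q (b (k + 1))) - N (p (b (k + 1)))) ≤
      1 / 2 / 2 ^ k := fun k => by
    obtain ⟨i, hi⟩ := hsucc k
    have := hgap i (b k)
    rw [hlen] at this
    rwa [dist_comm, Real.dist_eq, hi]
  have := dist_le_of_le_geometric_two_of_tendsto hdist hlim l.length
  rwa [← h.eq_of_mem (hlen l.length).symm hl (hb _), Real.dist_eq] at this

theorem exists_forall_mem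
    (hgap : ∀ i l, |(M (q (i :: l)) - N (p (i :: l))) - (M (q l) - N (p l))| ≤
      1 / 2 / 2 ^ l.length)
    (h : IsLelekScheme 𝒜 N P p) (h' : IsLelekScheme ℬ M Q q)
    (hY : IsLelek ℬ M) (x : X) : ∃ y, ∀ l, x ∈ P l → y ∈ Q l := by
  obtain ⟨b, hlen, hb, hsucc⟩ := h.exists_branch x
  have hQ : ∀ k j, k ≤ j → Q (b j) ⊆ Q (b k) := fun k j hkj => by
    induction j, hkj using Nat.le_induction with
    | base => exact subset_rfl
    | succ j _ ih =>
      obtain ⟨i, hi⟩ := hsucc j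
      exact fun y hy => ih ((h'.mem_iff _ y).2 ⟨i, hi ▸ hy⟩)
  have hbound : ∀ k, M (q (b k)) - N (p (b k)) ≤ M (q (b 0)) - N (p (b 0)) + (1 - 1 / 2 ^ k) :=
      fun k => by
    induction k with
    | zero => simp
    | succ k ih =>
      obtain ⟨i, hi⟩ := hsucc k
      have := (abs_le.1 (hgap i (b k))).2
      rw [← hi, hlen] at this
      have h2 : (1 : ℝ) / 2 / 2 ^ k = 1 / 2 ^ k - 1 / 2 ^ (k + 1) := by field_simp; ring
      linarith
  obtain ⟨y, hy, -⟩ := hY.compact ((hyperfilter ℕ).map fun k => q (b k))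
    ⟨M (q (b 0)) - N (p (b 0)) + 1 + N x, by
      rw [Ultrafilter.coe_map, eventually_map]
      refine .of_forall fun k => ?_
      have h1 := hbound k
      have h2 := h.min_le _ x (hb k)
      have h3 : (0 : ℝ) < 1 / 2 ^ k := by positivity
      linarith⟩
  refine ⟨y, fun l hl => ?_⟩
  rw [h.eq_of_mem (hlen l.length).symm hl (hb _)]
  by_contra hyl
  have hmem := hy _ (hY.algebra.compl_mem (h'.mem_algebra _)) hyl
  refine Ultrafilter.compl_mem_iff_notMem.1 hmem ?_
  rw [Ultrafilter.mem_map]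
  refine Nat.hyperfilter_le_atTop ?_
  filter_upwards [eventually_ge_atTop l.length] with j hj
  exact hQ _ _ hj (h'.min_mem _)

theorem continuous_of_forall_mem
    (hgap : ∀ i l, |(M (q (i :: l)) - N (p (i :: l))) - (M (q l) - N (p l))| ≤
      1 / 2 / 2 ^ l.length)
    [TopologicalSpace X] [TopologicalSpace Y]
    (hXt : ∀ x, 𝓝 x = coarseNhds 𝒜 x ⊓ comap N (𝓝 (N x)))
    (hYt : ∀ y, 𝓝 y = coarseNhds ℬ y ⊓ comap M (𝓝 (M y)))
    (h : IsLelekScheme 𝒜 N P p) (h' : IsLelekScheme ℬ M Q q)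
    (hX : IsLelek 𝒜 N) (hY : IsLelek ℬ M) {f : X → Y} (hf : ∀ x l, x ∈ P l → f x ∈ Q l) :
    Continuous f := by
  rw [continuous_iff_continuousAt]
  intro x
  have hNx : Tendsto N (𝓝 x) (𝓝 (N x)) := by
    rw [hXt]
    exact tendsto_comap.mono_left inf_le_right
  have hPx : ∀ l, x ∈ P l → P l ∈ 𝓝 x := fun l hl => by
    rw [hXt]
    exact mem_inf_of_left (mem_coarseNhds_of_mem (h.mem_algebra l) hl)
  obtain ⟨b, hlen, hb, -⟩ := h.exists_branch x
  rw [ContinuousAt, hYt, tendsto_inf, tendsto_comap_iff]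
  constructor
  · intro s hs
    obtain ⟨a, ha, hya, has⟩ := (mem_coarseNhds hY.algebra).1 hs
    obtain ⟨k, hk⟩ := h'.decides a ha
    rw [mem_map]
    filter_upwards [hPx _ (hb k)] with z hz
    rcases hk (b k) (hlen k).ge with hl | hl
    · exact has (hl (hf z _ hz))
    · exact absurd hya (disjoint_left.1 hl (hf x _ (hb k)))
  · rw [Metric.tendsto_nhds]
    intro ε hε
    obtain ⟨k, hk⟩ := exists_pow_lt_of_lt_one (show 0 < ε / 3 by positivity)
      (show (1 / 2 : ℝ) < 1 by norm_num)
    filter_upwards [hPx _ (hb k), Metric.tendsto_nhds.1 hNx (ε / 3) (by positivity)] with z hz hzN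
    have h1 := abs_le.1 (abs_gap_sub_le hgap h h' hX hY (hf x) (hb k))
    have h2 := abs_le.1 (abs_gap_sub_le hgap h h' hX hY (hf z) hz)
    rw [hlen, ← one_div_pow] at h1 h2
    rw [Real.dist_eq, abs_lt] at hzN
    rw [Real.dist_eq, Function.comp_apply, abs_lt]
    constructor <;> linarith [h1.1, h1.2, h2.1, h2.2, hzN.1, hzN.2]

end IsLelekScheme

theorem LelekNode.exists_scheme {X Y : Type*} {𝒜 : Set (Set X)} {N : X → ℝ} {ℬ : Set (Set Y)}
    {M : Y → ℝ} (hX : IsLelek 𝒜 N) (hY : IsLelek ℬ M) [Nonempty X] [Nonempty Y] :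
    ∃ T : List (Bool × Bool) → LelekNode 𝒜 N ℬ M,
      IsLelekScheme 𝒜 N (fun l => (T l).P) (fun l => (T l).p) ∧
      IsLelekScheme ℬ M (fun l => (T l).Q) (fun l => (T l).q) ∧
      ∀ i l, |(T (i :: l)).gap - (T l).gap| ≤ 1 / 2 / 2 ^ l.length := by
  obtain ⟨A, hA⟩ := hX.countable.exists_eq_range ⟨_, hX.algebra.empty_mem⟩
  obtain ⟨B, hB⟩ := hY.countable.exists_eq_range ⟨_, hY.algebra.empty_mem⟩
  obtain ⟨p, hp, hple⟩ := hX.exists_isMinOn hX.algebra.univ_mem univ_nonempty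
  obtain ⟨q, hq, hqle⟩ := hY.exists_isMinOn hY.algebra.univ_mem univ_nonempty
  choose step hstep hdec using fun (n : LelekNode 𝒜 N ℬ M) (k : ℕ) =>
    exists_refines_both hX hY n (hA ▸ mem_range_self k : A k ∈ 𝒜)
      (hB ▸ mem_range_self k : B k ∈ ℬ) (show (0 : ℝ) < 1 / 2 / 2 ^ k by positivity)
  let T : List (Bool × Bool) → LelekNode 𝒜 N ℬ M := fun l => List.rec
    ⟨univ, univ, p, q, hX.algebra.univ_mem, hY.algebra.univ_mem, hp, hq, hple, hqle⟩
    (fun i l n => step n l.length i) l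
  have hT : ∀ l, (T l).Refines (fun i => T (i :: l)) (1 / 2 / 2 ^ l.length) :=
    fun l => hstep (T l) l.length
  have hTdec : ∀ k l, k + 1 ≤ l.length → ((T l).P ⊆ A k ∨ Disjoint (T l).P (A k)) ∧
      ((T l).Q ⊆ B k ∨ Disjoint (T l).Q (B k)) := fun k l => by
    induction l with
    | nil => simp
    | cons i l ih =>
      intro hl
      rcases (Nat.le_of_lt_succ hl).eq_or_lt with rfl | hlt
      · exact hdec (T l) l.length i
      · have hP : (T (i :: l)).P ⊆ (T l).P := fun x hx => ((hT l).P_iff x).2 ⟨i, hx⟩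
        have hQ : (T (i :: l)).Q ⊆ (T l).Q := fun x hx => ((hT l).Q_iff x).2 ⟨i, hx⟩
        exact ⟨(ih hlt).1.imp hP.trans (Disjoint.mono_left hP),
          (ih hlt).2.imp hQ.trans (Disjoint.mono_left hQ)⟩
  refine ⟨T, ⟨rfl, fun l => (T l).P_mem, fun l => (hT l).P_iff, fun l => (hT l).P_inj,
    fun l => (T l).p_mem, fun l => (T l).p_le, fun a ha => ?_⟩,
    ⟨rfl, fun l => (T l).Q_mem, fun l => (hT l).Q_iff, fun l => (hT l).Q_inj,
    fun l => (T l).q_mem, fun l => (T l).q_le, fun b hb => ?_⟩, fun i l => (hT l).gap_le i⟩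
  · obtain ⟨k, rfl⟩ := hA ▸ ha
    exact ⟨k + 1, fun l hl => (hTdec k l hl).1⟩
  · obtain ⟨k, rfl⟩ := hB ▸ hb
    exact ⟨k + 1, fun l hl => (hTdec k l hl).2⟩

/-- Any two nonempty spaces topologized by Lelek structures are homeomorphic. -/
theorem IsLelek.nonempty_homeomorph {X Y : Type*} [TopologicalSpace X] [TopologicalSpace Y]
    [Nonempty X] [Nonempty Y] {𝒜 : Set (Set X)} {N : X → ℝ} {ℬ : Set (Set Y)} {M : Y → ℝ}
    (hX : IsLelek 𝒜 N) (hXt : ∀ x, 𝓝 x = coarseNhds 𝒜 x ⊓ comap N (𝓝 (N x)))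
    (hY : IsLelek ℬ M) (hYt : ∀ y, 𝓝 y = coarseNhds ℬ y ⊓ comap M (𝓝 (M y))) :
    Nonempty (X ≃ₜ Y) := by
  obtain ⟨T, hP, hQ, hgap⟩ := LelekNode.exists_scheme hX hY
  have hgap' : ∀ i l, |(N (T (i :: l)).p - M (T (i :: l)).q) - (N (T l).p - M (T l).q)| ≤
      1 / 2 / 2 ^ l.length := fun i l => by
    have := hgap i l
    rw [abs_sub_comm] at this
    convert! this using 2
    simp only [LelekNode.gap]
    ring
  choose f hf using hP.exists_forall_mem hgap hQ hY
  choose g hg using hQ.exists_forall_mem hgap' hP hX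
  refine ⟨⟨⟨f, g, fun x => ?_, fun y => ?_⟩, ?_, ?_⟩⟩
  · refine hP.eq_of_forall_mem hX fun k => ?_
    obtain ⟨b, hlen, hb, -⟩ := hP.exists_branch x
    exact ⟨b k, hlen k, hg _ _ (hf _ _ (hb k)), hb k⟩
  · refine hQ.eq_of_forall_mem hY fun k => ?_
    obtain ⟨b, hlen, hb, -⟩ := hQ.exists_branch y
    exact ⟨b k, hlen k, hf _ _ (hg _ _ (hb k)), hb k⟩
  · exact IsLelekScheme.continuous_of_forall_mem hgap hXt hYt hP hQ hX hY hf
  · exact IsLelekScheme.continuous_of_forall_mem hgap' hYt hXt hQ hP hY hX hg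

namespace CompleteErdosSpace

theorem coord_eq (x : CompleteErdosSpace) (i : ℕ) :
    x.1 i = 0 ∨ ∃ m : ℕ, x.1 i = 1 / ((m : ℝ) + 1) := by
  refine (x.2 i).imp id ?_
  rintro ⟨m, hm, h⟩
  obtain ⟨k, rfl⟩ := Nat.exists_eq_succ_of_ne_zero hm.ne'
  exact ⟨k, by simpa using h⟩

theorem coord_nonneg (x : CompleteErdosSpace) (i : ℕ) : 0 ≤ x.1 i := by
  rcases x.coord_eq i with h | ⟨m, h⟩ <;> rw [h]
  positivity

theorem hasSum_sq (x : lp (fun _ : ℕ => ℝ) 2) : HasSum (fun i => x i ^ 2) (‖x‖ ^ 2) := by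
  have h := lp.hasSum_norm (p := 2) (by norm_num) x
  simpa using h

theorem sum_sq_le (x : lp (fun _ : ℕ => ℝ) 2) (s : Finset ℕ) : ∑ i ∈ s, x i ^ 2 ≤ ‖x‖ ^ 2 :=
  sum_le_hasSum s (fun i _ => sq_nonneg (x i)) (hasSum_sq x)

theorem exists_of_sum_sq_le {f : ℕ → ℝ} (hf : ∀ i, f i = 0 ∨ ∃ m : ℕ, f i = 1 / ((m : ℝ) + 1))
    {C : ℝ} (hC : ∀ s : Finset ℕ, ∑ i ∈ s, f i ^ 2 ≤ C) :
    ∃ x : CompleteErdosSpace, ∀ i, x.1 i = f i := by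
  have hmem : Memℓp f 2 := memℓp_gen' (C := C) fun s => by simpa using hC s
  refine ⟨⟨⟨f, hmem⟩, fun i => (hf i).imp id ?_⟩, fun i => rfl⟩
  rintro ⟨m, hm⟩
  exact ⟨m + 1, m.succ_pos, by simpa using hm⟩

/-- The points whose `i`-th coordinate is at least `1 / (m + 1)`. -/
def coordGE (im : ℕ × ℕ) : Set CompleteErdosSpace := {x | 1 / ((im.2 : ℝ) + 1) ≤ x.1 im.1}

/-- The algebra generated by the coordinate sets. -/
def algebra : Set (Set CompleteErdosSpace) := generateSetAlgebra (range coordGE)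

/-- The norm of `ℓ²`, restricted to complete Erdős space. -/
def norm (x : CompleteErdosSpace) : ℝ := ‖x.1‖

theorem coordGE_mem (i m : ℕ) : coordGE (i, m) ∈ algebra :=
  self_subset_generateSetAlgebra ⟨(i, m), rfl⟩

theorem coordGE_eq (i m : ℕ) :
    coordGE (i, m) = {x : CompleteErdosSpace | 1 / ((m : ℝ) + 2) < x.1 i} := by
  ext x
  simp only [coordGE, mem_ofPred_eq]
  refine ⟨fun h => lt_of_lt_of_le (by gcongr; norm_num) h, fun h => ?_⟩
  rcases x.coord_eq i with h0 | ⟨k, hk⟩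
  · rw [h0] at h
    exact absurd h (not_lt.2 (by positivity))
  · rw [hk] at h ⊢
    have := lt_of_one_div_lt_one_div (by positivity) h
    have hkm : k < m + 1 := by
      have : (k : ℝ) < m + 1 := by linarith
      exact_mod_cast this
    have : (k : ℝ) ≤ m := by exact_mod_cast Nat.lt_succ_iff.1 hkm
    gcongr

theorem continuous_val : Continuous (fun x : CompleteErdosSpace => x.1) := continuous_subtype_val

theorem continuous_coord (i : ℕ) : Continuous (fun x : CompleteErdosSpace => x.1 i) :=
  ((continuous_apply i).comp lp.uniformContinuous_coe.continuous).comp continuous_val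

theorem isClopen_of_mem_algebra {a : Set CompleteErdosSpace} (ha : a ∈ algebra) : IsClopen a := by
  induction ha with
  | base a ha =>
    obtain ⟨⟨i, m⟩, rfl⟩ := ha
    refine ⟨isClosed_le continuous_const (continuous_coord i), ?_⟩
    rw [coordGE_eq]
    exact isOpen_lt continuous_const (continuous_coord i)
  | empty => exact isClopen_empty
  | compl a _ ih => exact ih.compl
  | union a b _ _ iha ihb => exact iha.union ihb

theorem exists_mem_iff_of_eq {a : Set CompleteErdosSpace} (ha : a ∈ algebra) :
    ∃ K, ∀ x y : CompleteErdosSpace, (∀ i < K, x.1 i = y.1 i) → (x ∈ a ↔ y ∈ a) := by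
  induction ha with
  | base a ha =>
    obtain ⟨⟨i, m⟩, rfl⟩ := ha
    exact ⟨i + 1, fun x y h => by simp only [coordGE, mem_ofPred_eq, h i i.lt_succ_self]⟩
  | empty => exact ⟨0, by simp⟩
  | compl a _ ih =>
    obtain ⟨K, hK⟩ := ih
    exact ⟨K, fun x y h => not_congr (hK x y h)⟩
  | union a b _ _ iha ihb =>
    obtain ⟨K, hK⟩ := iha
    obtain ⟨L, hL⟩ := ihb
    exact ⟨max K L, fun x y h => or_congr
      (hK x y fun i hi => h i (lt_max_of_lt_left hi)) (hL x y fun i hi => h i (lt_max_of_lt_right hi))⟩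

theorem exists_separating {x y : CompleteErdosSpace} (hxy : x ≠ y) :
    ∃ a ∈ algebra, x ∈ a ∧ y ∉ a := by
  have hlt : ∀ u v : CompleteErdosSpace, ∀ i, u.1 i < v.1 i → ∃ m, v ∈ coordGE (i, m) ∧
      u ∉ coordGE (i, m) := fun u v i h => by
    rcases v.coord_eq i with h0 | ⟨m, hm⟩
    · exact absurd (u.coord_nonneg i) (not_le.2 (h0 ▸ h))
    · exact ⟨m, hm.ge, not_le.2 (hm ▸ h)⟩
  obtain ⟨i, hi⟩ : ∃ i, x.1 i ≠ y.1 i := by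
    by_contra! h
    exact hxy (Subtype.ext (lp.ext (funext h)))
  rcases hi.lt_or_gt with h | h
  · obtain ⟨m, hy, hx⟩ := hlt x y i h
    exact ⟨_, isSetAlgebra_generateSetAlgebra.compl_mem (coordGE_mem i m), hx, not_not.2 hy⟩
  · obtain ⟨m, hx, hy⟩ := hlt y x i h
    exact ⟨_, coordGE_mem i m, hx, hy⟩

theorem exists_limit (U : Ultrafilter CompleteErdosSpace)
    (hU : ∃ r, ∀ᶠ x in (U : Filter CompleteErdosSpace), norm x ≤ r) :
    ∃ x, (∀ a ∈ algebra, x ∈ a → a ∈ U) ∧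
      ∀ r, (∀ᶠ y in (U : Filter CompleteErdosSpace), norm y ≤ r) → norm x ≤ r := by
  have hc : ∀ i, ∃ c : ℝ, (c = 0 ∨ ∃ m : ℕ, c = 1 / ((m : ℝ) + 1)) ∧
      (∀ m : ℕ, 1 / ((m : ℝ) + 1) ≤ c ↔ coordGE (i, m) ∈ U) ∧
      ∀ᶠ x in (U : Filter CompleteErdosSpace), c ≤ x.1 i := fun i => by
    classical
    by_cases h : ∃ m, coordGE (i, m) ∈ U
    · refine ⟨1 / ((Nat.find h : ℝ) + 1), .inr ⟨_, rfl⟩, fun m => ⟨fun hm => ?_, fun hm => ?_⟩,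
        Nat.find_spec h⟩
      · filter_upwards [Nat.find_spec h] with x hx using hm.trans hx
      · have : (Nat.find h : ℝ) ≤ m := by exact_mod_cast Nat.find_min' h hm
        gcongr
    · push Not at h
      refine ⟨0, .inl rfl, fun m => iff_of_false (not_le.2 (by positivity)) (h m),
        .of_forall fun x => x.coord_nonneg i⟩
  choose c hc0 hcU hcle using hc
  have hc_nonneg : ∀ i, 0 ≤ c i := fun i => by
    rcases hc0 i with h | ⟨m, h⟩ <;> rw [h]
    positivity
  have hsum : ∀ r, (∀ᶠ y in (U : Filter CompleteErdosSpace), norm y ≤ r) → 0 ≤ r ∧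
      ∀ s : Finset ℕ, ∑ i ∈ s, c i ^ 2 ≤ r ^ 2 := fun r hr => by
    refine ⟨?_, fun s => ?_⟩
    · obtain ⟨x, hx⟩ := hr.exists
      exact (norm_nonneg x.1).trans hx
    · obtain ⟨x, hx, hxs⟩ := (hr.and ((Filter.eventually_all_finset s).2 fun i _ => hcle i)).exists
      calc ∑ i ∈ s, c i ^ 2 ≤ ∑ i ∈ s, x.1 i ^ 2 :=
            Finset.sum_le_sum fun i hi => pow_le_pow_left₀ (hc_nonneg i) (hxs i hi) 2
        _ ≤ ‖x.1‖ ^ 2 := sum_sq_le x.1 s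
        _ ≤ r ^ 2 := pow_le_pow_left₀ (norm_nonneg _) hx 2
  obtain ⟨r, hr⟩ := hU
  obtain ⟨x, hx⟩ := exists_of_sum_sq_le hc0 (hsum r hr).2
  have hiff : ∀ a ∈ algebra, x ∈ a ↔ a ∈ U := fun a ha => by
    induction ha with
    | base a ha =>
      obtain ⟨⟨i, m⟩, rfl⟩ := ha
      rw [← hcU i m, ← hx]
      rfl
    | empty => simp
    | compl a _ ih => rw [mem_compl_iff, ih, Ultrafilter.compl_mem_iff_notMem]
    | union a b _ _ iha ihb => rw [mem_union, iha, ihb, Ultrafilter.union_mem_iff]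
  refine ⟨x, fun a ha => (hiff a ha).1, fun r hr => ?_⟩
  obtain ⟨hr0, hrs⟩ := hsum r hr
  refine abs_le_of_sq_le_sq' ?_ hr0 |>.2
  refine (hasSum_sq x.1).tsum_eq ▸ Real.tsum_le_of_sum_le (fun i => sq_nonneg _) fun s => ?_
  simpa only [hx] using hrs s

theorem exists_norm_mem_Ioo {a : Set CompleteErdosSpace} (ha : a ∈ algebra)
    {x : CompleteErdosSpace} (hx : x ∈ a) {r s : ℝ} (hxr : norm x ≤ r) (hrs : r < s) :
    ∃ y ∈ a, r < norm y ∧ norm y < s := by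
  obtain ⟨K, hK⟩ := exists_mem_iff_of_eq ha
  have hr0 : 0 ≤ r := (norm_nonneg x.1).trans hxr
  have hsq : 0 < s ^ 2 - r ^ 2 := sub_pos.2 (pow_lt_pow_left₀ hrs hr0 two_ne_zero)
  obtain ⟨m, hm⟩ := exists_nat_one_div_lt hsq
  set δ : ℝ := 1 / ((m : ℝ) + 1) with hδ
  have hδ0 : 0 < δ := by positivity
  have hδ1 : δ ≤ 1 := by
    rw [hδ, div_le_one (by positivity)]
    linarith [Nat.cast_nonneg (α := ℝ) m]
  have hδ2 : δ ^ 2 < s ^ 2 - r ^ 2 := lt_of_le_of_lt (by nlinarith) hm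
  set σ := ∑ i ∈ Finset.range K, x.1 i ^ 2 with hσ
  have hσr : σ ≤ r ^ 2 := (sum_sq_le x.1 _).trans (pow_le_pow_left₀ (norm_nonneg _) hxr 2)
  set L := ⌊(r ^ 2 - σ) / δ ^ 2⌋₊ + 1 with hL
  have hL1 : (r ^ 2 - σ) / δ ^ 2 < L := by
    rw [hL]
    push_cast
    exact Nat.lt_floor_add_one _
  have hL2 : (L : ℝ) ≤ (r ^ 2 - σ) / δ ^ 2 + 1 := by
    rw [hL]
    push_cast
    linarith [Nat.floor_le (div_nonneg (sub_nonneg.2 hσr) (sq_nonneg δ))]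
  rw [div_lt_iff₀ (by positivity)] at hL1
  have hL3 : L * δ ^ 2 ≤ r ^ 2 - σ + δ ^ 2 := by
    calc L * δ ^ 2 ≤ ((r ^ 2 - σ) / δ ^ 2 + 1) * δ ^ 2 := by gcongr
      _ = r ^ 2 - σ + δ ^ 2 := by field_simp
  let f : ℕ → ℝ := fun i => if i < K then x.1 i else if i < K + L then δ else 0
  have hf : ∀ i, f i = 0 ∨ ∃ k : ℕ, f i = 1 / ((k : ℝ) + 1) := fun i => by
    by_cases h1 : i < K
    · simpa only [f, h1, if_true] using x.coord_eq i
    · by_cases h2 : i < K + L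
      · exact .inr ⟨m, by simp only [f, h1, h2, if_true, if_false, hδ]⟩
      · exact .inl (by simp only [f, h1, h2, if_false])
  have hfsum : HasSum (fun i => f i ^ 2) (σ + L * δ ^ 2) := by
    have h : ∑ i ∈ Finset.range (K + L), f i ^ 2 = σ + L * δ ^ 2 := by
      rw [Finset.sum_range_add, hσ]
      congr 1
      · exact Finset.sum_congr rfl fun i hi => by simp [f, Finset.mem_range.1 hi]
      · rw [Finset.sum_congr rfl (g := fun _ => δ ^ 2)]
        · simp
        · intro i hi
          simp [f, Finset.mem_range.1 hi]
    rw [← h]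
    refine hasSum_sum_of_ne_finset_zero fun i hi => ?_
    have hi' : K + L ≤ i := by simpa using hi
    simp [f, not_lt.2 hi', not_lt.2 (le_trans (Nat.le_add_right K L) hi')]
  obtain ⟨y, hy⟩ := exists_of_sum_sq_le hf
    fun t => sum_le_hasSum t (fun i _ => sq_nonneg (f i)) hfsum
  have hynorm : norm y ^ 2 = σ + L * δ ^ 2 := by
    refine (hasSum_sq y.1).unique ?_
    simpa only [hy] using hfsum
  refine ⟨y, (hK x y fun i hi => by rw [hy]; simp [f, hi]).1 hx, ?_, ?_⟩
  · exact lt_of_pow_lt_pow_left₀ 2 (norm_nonneg y.1) (by linarith)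
  · exact lt_of_pow_lt_pow_left₀ 2 (hr0.trans hrs.le) (by linarith)

theorem isLelek : IsLelek algebra norm where
  countable := countable_generateSetAlgebra (countable_range _)
  algebra := isSetAlgebra_generateSetAlgebra
  separates _ _ := exists_separating
  nonneg x := norm_nonneg x.1
  compact := exists_limit
  dense _ ha _ hx _ _ hxr hrs := exists_norm_mem_Ioo ha hx hxr hrs

theorem tendsto_val_of_coarseNhds (x : CompleteErdosSpace) :
    Tendsto (fun y : CompleteErdosSpace => y.1) (coarseNhds algebra x ⊓ comap norm (𝓝 (norm x)))
      (𝓝 x.1) := by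
  set l := coarseNhds algebra x ⊓ comap norm (𝓝 (norm x))
  have hnorm : Tendsto norm l (𝓝 (norm x)) := tendsto_comap.mono_left inf_le_right
  have hcoord : ∀ i, ∀ᶠ y in l, x.1 i ≤ y.1 i := fun i => by
    rcases x.coord_eq i with h | ⟨m, h⟩
    · exact .of_forall fun y => h ▸ y.coord_nonneg i
    · rw [h]
      exact mem_inf_of_left (mem_coarseNhds_of_mem (coordGE_mem i m) h.ge)
  have hmin : Tendsto (fun y : CompleteErdosSpace => ∑' i, min (y.1 i ^ 2) (x.1 i ^ 2)) l
      (𝓝 (∑' i, x.1 i ^ 2)) := by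
    refine tendsto_tsum_of_dominated_convergence (hasSum_sq x.1).summable (fun i => ?_)
      (.of_forall fun y i => ?_)
    · refine tendsto_const_nhds.congr' ?_
      filter_upwards [hcoord i] with y hy
      exact (min_eq_right (pow_le_pow_left₀ (x.coord_nonneg i) hy 2)).symm
    · rw [Real.norm_of_nonneg (le_min (sq_nonneg _) (sq_nonneg _))]
      exact min_le_right _ _
  rw [(hasSum_sq x.1).tsum_eq] at hmin
  have hbound : ∀ y : CompleteErdosSpace, ‖y.1 - x.1‖ ^ 2 ≤
      norm y ^ 2 + norm x ^ 2 - 2 * ∑' i, min (y.1 i ^ 2) (x.1 i ^ 2) := fun y => by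
    have hs : Summable fun i => min (y.1 i ^ 2) (x.1 i ^ 2) :=
      .of_nonneg_of_le (fun i => le_min (sq_nonneg _) (sq_nonneg _)) (fun i => min_le_right _ _)
        (hasSum_sq x.1).summable
    refine hasSum_le (fun i => ?_) (hasSum_sq (y.1 - x.1))
      (((hasSum_sq y.1).add (hasSum_sq x.1)).sub (hs.hasSum.mul_left 2))
    have hx := x.coord_nonneg i
    have hy := y.coord_nonneg i
    rw [lp.coeFn_sub, Pi.sub_apply]
    rcases le_total (y.1 i) (x.1 i) with h | h
    · rw [min_eq_left (pow_le_pow_left₀ hy h 2)]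
      nlinarith
    · rw [min_eq_right (pow_le_pow_left₀ hx h 2)]
      nlinarith
  have hlim : Tendsto (fun y => norm y ^ 2 + norm x ^ 2 -
      2 * ∑' i, min (y.1 i ^ 2) (x.1 i ^ 2)) l (𝓝 0) := by
    have := ((hnorm.pow 2).add_const (norm x ^ 2)).sub (hmin.const_mul 2)
    convert! this using 2
    simp only [norm]
    ring
  have hsq := squeeze_zero (fun y => sq_nonneg _) hbound hlim
  rw [tendsto_iff_norm_sub_tendsto_zero]
  have := (Real.continuous_sqrt.tendsto 0).comp hsq
  rw [Real.sqrt_zero] at this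
  exact this.congr fun y => Real.sqrt_sq (norm_nonneg _)

theorem nhds_eq (x : CompleteErdosSpace) :
    𝓝 x = coarseNhds algebra x ⊓ comap norm (𝓝 (norm x)) := by
  refine le_antisymm (le_inf ?_ ?_) ?_
  · refine le_iInf₂ fun a ha => le_principal_iff.2 ?_
    exact (isClopen_of_mem_algebra ha.1).isOpen.mem_nhds ha.2
  · exact tendsto_iff_comap.1 (continuous_norm.comp continuous_val).continuousAt
  · have h : 𝓝 x = comap (fun y : CompleteErdosSpace => y.1) (𝓝 x.1) := nhds_induced _ _
    rw [h, ← tendsto_iff_comap]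
    exact tendsto_val_of_coarseNhds x

instance : Nonempty CompleteErdosSpace :=
  ⟨⟨0, fun _ => .inl rfl⟩⟩

end CompleteErdosSpace

section LowerSemicontinuousSums

variable {α : Type*} {l : Filter α} {g : ℕ → α → ℝ} {G : ℕ → ℝ}

theorem tendsto_tsum_min (hg : ∀ k x, 0 ≤ g k x) (hG : ∀ k, 0 ≤ G k) (hGs : Summable G)
    (hlsc : ∀ k, ∀ t < G k, ∀ᶠ x in l, t < g k x) :
    Tendsto (fun x => ∑' k, min (g k x) (G k)) l (𝓝 (∑' k, G k)) := by
  refine tendsto_tsum_of_dominated_convergence hGs (fun k => ?_) (.of_forall fun x k => ?_)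
  · refine tendsto_order.2 ⟨fun t ht => ?_, fun t ht => .of_forall fun x =>
      (min_le_right _ _).trans_lt ht⟩
    filter_upwards [hlsc k t ht] with x hx using lt_min hx ht
  · rw [Real.norm_of_nonneg (le_min (hg k x) (hG k))]
    exact min_le_right _ _

theorem summable_min (hg : ∀ k x, 0 ≤ g k x) (hG : ∀ k, 0 ≤ G k) (hGs : Summable G) (x : α) :
    Summable fun k => min (g k x) (G k) :=
  .of_nonneg_of_le (fun k => le_min (hg k x) (hG k)) (fun _ => min_le_right _ _) hGs

theorem eventually_lt_tsum (hg : ∀ k x, 0 ≤ g k x) (hgs : ∀ x, Summable fun k => g k x)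
    (hG : ∀ k, 0 ≤ G k) (hGs : Summable G) (hlsc : ∀ k, ∀ t < G k, ∀ᶠ x in l, t < g k x)
    {t : ℝ} (ht : t < ∑' k, G k) : ∀ᶠ x in l, t < ∑' k, g k x := by
  filter_upwards [(tendsto_order.1 (tendsto_tsum_min hg hG hGs hlsc)).1 t ht] with x hx
  exact hx.trans_le ((summable_min hg hG hGs x).tsum_le_tsum (fun k => min_le_left _ _) (hgs x))

/-- If a sum of nonnegative lower semicontinuous terms converges, then so does each term. -/
theorem tendsto_of_tendsto_tsum (hg : ∀ k x, 0 ≤ g k x) (hgs : ∀ x, Summable fun k => g k x)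
    (hG : ∀ k, 0 ≤ G k) (hGs : Summable G) (hlsc : ∀ k, ∀ t < G k, ∀ᶠ x in l, t < g k x)
    (hlim : Tendsto (fun x => ∑' k, g k x) l (𝓝 (∑' k, G k))) (k : ℕ) :
    Tendsto (g k) l (𝓝 (G k)) := by
  have hdiff := hlim.sub (tendsto_tsum_min hg hG hGs hlsc)
  rw [sub_self] at hdiff
  refine tendsto_order.2 ⟨hlsc k, fun t ht => ?_⟩
  filter_upwards [(tendsto_order.1 hdiff).2 (t - G k) (sub_pos.2 ht)] with x hx
  have hs := (hgs x).sub (summable_min hg hG hGs x)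
  rw [← (hgs x).tsum_sub (summable_min hg hG hGs x)] at hx
  have hk := hs.le_tsum k fun j _ => sub_nonneg.2 (min_le_left (g j x) (G j))
  linarith [min_le_right (g k x) (G k)]

end LowerSemicontinuousSums

section SupOn

variable {X : Type*} {N : X → ℝ} {a b S : Set X} {t : ℝ}

/-- The largest value of a nonnegative function on `S ∩ a`, or `0` if this set is empty. -/
def supOn (N : X → ℝ) (a S : Set X) : ℝ := sSup (N '' (S ∩ a))

theorem le_supOn (hS : S.Finite) {x : X} (hx : x ∈ S) (hxa : x ∈ a) : N x ≤ supOn N a S :=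
  le_csSup ((hS.inter_of_left a).image N).bddAbove ⟨x, ⟨hx, hxa⟩, rfl⟩

theorem supOn_le (ht : 0 ≤ t) (h : ∀ x ∈ S, x ∈ a → N x ≤ t) : supOn N a S ≤ t :=
  Real.sSup_le (by rintro _ ⟨x, hx, rfl⟩; exact h x hx.1 hx.2) ht

theorem supOn_nonneg (hN : ∀ x, 0 ≤ N x) : 0 ≤ supOn N a S :=
  Real.sSup_nonneg (by rintro _ ⟨x, -, rfl⟩; exact hN x)

theorem exists_of_lt_supOn (ht : 0 ≤ t) (h : t < supOn N a S) : ∃ x ∈ S, x ∈ a ∧ t < N x := by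
  by_contra! hcon
  exact absurd (supOn_le ht hcon) (not_le.2 h)

theorem supOn_lt (hS : S.Finite) (ht : 0 < t) (h : ∀ x ∈ S, x ∈ a → N x < t) :
    supOn N a S < t := by
  rcases (S ∩ a).eq_empty_or_nonempty with he | hne
  · simpa [supOn, he] using ht
  · obtain ⟨x, hx, hxs⟩ := (hne.image N).csSup_mem ((hS.inter_of_left a).image N)
    rw [supOn, ← hxs]
    exact h x hx.1 hx.2

theorem supOn_le_univ (hN : ∀ x, 0 ≤ N x) (hS : S.Finite) : supOn N a S ≤ supOn N univ S :=
  supOn_le (supOn_nonneg hN) fun _ hx _ => le_supOn hS hx (mem_univ _)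

open Classical in
theorem supOn_insert (hN : ∀ x, 0 ≤ N x) (hS : S.Finite) (y : X) :
    supOn N a (insert y S) = max (supOn N a S) (if y ∈ a then N y else 0) := by
  have hfin := hS.insert y
  refine le_antisymm (supOn_le (le_max_of_le_left (supOn_nonneg hN)) ?_) (max_le ?_ ?_)
  · rintro x (rfl | hx) hxa
    · exact le_max_of_le_right (by rw [if_pos hxa])
    · exact le_max_of_le_left (le_supOn hS hx hxa)
  · exact supOn_le (supOn_nonneg hN) fun x hx hxa => le_supOn hfin (mem_insert_of_mem y hx) hxa
  · split_ifs with hy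
    · exact le_supOn hfin (mem_insert y S) hy
    · exact supOn_nonneg hN

/-- The weighted sum of the suprema of `N` over the traces of the sets `A k`. -/
def weightedSup (N : X → ℝ) (A : ℕ → Set X) (S : Set X) : ℝ :=
  ∑' k, (1 / 2 : ℝ) ^ k * supOn N (A k) S

theorem summable_weighted {f : ℕ → ℝ} {C : ℝ} (hf : ∀ k, 0 ≤ f k) (hC : ∀ k, f k ≤ C) :
    Summable fun k => (1 / 2 : ℝ) ^ k * f k :=
  .of_nonneg_of_le (fun k => mul_nonneg (by positivity) (hf k))
    (fun k => mul_le_mul_of_nonneg_left (hC k) (by positivity)) (summable_geometric_two.mul_right C)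

theorem summable_weightedSup (hN : ∀ x, 0 ≤ N x) (A : ℕ → Set X) (hS : S.Finite) :
    Summable fun k => (1 / 2 : ℝ) ^ k * supOn N (A k) S :=
  summable_weighted (fun _ => supOn_nonneg hN) fun _ => supOn_le_univ hN hS

theorem weighted_supOn_nonneg (hN : ∀ x, 0 ≤ N x) (A : ℕ → Set X) (k : ℕ) (S : Set X) :
    0 ≤ (1 / 2 : ℝ) ^ k * supOn N (A k) S :=
  mul_nonneg (by positivity) (supOn_nonneg hN)

theorem le_weightedSup (hN : ∀ x, 0 ≤ N x) {A : ℕ → Set X} (hA : A 0 = univ) (hS : S.Finite)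
    {x : X} (hx : x ∈ S) : N x ≤ weightedSup N A S := by
  have h := (summable_weightedSup hN A hS).le_tsum 0 fun k _ => weighted_supOn_nonneg hN A k S
  rw [pow_zero, one_mul, hA] at h
  exact (le_supOn hS hx (mem_univ x)).trans h

end SupOn

theorem IsLelek.neBot_coarseNhds_inf_comap {X : Type*} {𝒜 : Set (Set X)} {N : X → ℝ}
    (hX : IsLelek 𝒜 N) {x : X} {v : ℝ} (hv : N x ≤ v) :
    (coarseNhds 𝒜 x ⊓ comap N (𝓝 v)).NeBot := by
  rw [inf_neBot_iff]
  rintro s hs t ⟨w, hw, hwt⟩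
  obtain ⟨a, ha, hxa, has⟩ := (mem_coarseNhds hX.algebra).1 hs
  obtain ⟨ε, hε, hεw⟩ := Metric.mem_nhds_iff.1 hw
  obtain ⟨y, hya, hvy, hyv⟩ := hX.dense a ha x hxa v (v + ε) hv (by linarith)
  refine ⟨y, has hya, hwt (hεw ?_)⟩
  rw [Metric.mem_ball, Real.dist_eq, abs_lt]
  constructor <;> linarith

namespace HypFn

variable {X : Type*} [TopologicalSpace X] {n : ℕ} {𝒜 : Set (Set X)} {N : X → ℝ} {A : ℕ → Set X}

/-- The members of the symmetric product which meet `a`. -/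
def hit (n : ℕ) (a : Set X) : Set (HypFn n X) := {F | (F.1 ∩ a).Nonempty}

/-- The algebra generated by the sets `hit n a` with `a ∈ 𝒜`. -/
def hitAlgebra (n : ℕ) (𝒜 : Set (Set X)) : Set (Set (HypFn n X)) :=
  generateSetAlgebra (hit n '' 𝒜)

theorem hit_mem {a : Set X} (ha : a ∈ 𝒜) : hit n a ∈ hitAlgebra n 𝒜 :=
  self_subset_generateSetAlgebra ⟨a, ha, rfl⟩

theorem isSetAlgebra_hitAlgebra : IsSetAlgebra (hitAlgebra n 𝒜) := isSetAlgebra_generateSetAlgebra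

theorem isOpen_hit {U : Set X} (hU : IsOpen U) : IsOpen (hit n U) := by
  rcases U.eq_empty_or_nonempty with rfl | hne
  · simp [hit]
  · exact ⟨_, .basic _ (.inr ⟨U, hU, hne, rfl⟩), rfl⟩

theorem isOpen_subset {U : Set X} (hU : IsOpen U) : IsOpen {F : HypFn n X | F.1 ⊆ U} := by
  rcases U.eq_empty_or_nonempty with rfl | hne
  · have : {F : HypFn n X | F.1 ⊆ ∅} = ∅ :=
      eq_empty_of_forall_notMem fun F hF => F.2.1.ne_empty (subset_empty_iff.1 hF)
    rw [this]
    exact isOpen_empty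
  · exact ⟨_, .basic _ (.inl ⟨U, hU, hne, rfl⟩), rfl⟩

theorem compl_hit (a : Set X) : (hit n a)ᶜ = {F : HypFn n X | F.1 ⊆ aᶜ} := by
  ext F
  simp [hit, not_nonempty_iff_eq_empty, ← disjoint_iff_inter_eq_empty,
    subset_compl_iff_disjoint_right]

theorem le_nhds {l : Filter (HypFn n X)} {G : HypFn n X}
    (hsub : ∀ U, IsOpen U → G.1 ⊆ U → ∀ᶠ F in l, F.1 ⊆ U)
    (hhit : ∀ U, IsOpen U → (G.1 ∩ U).Nonempty → ∀ᶠ F in l, (F.1 ∩ U).Nonempty) : l ≤ 𝓝 G := by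
  have h : 𝓝 G = comap (fun F : HypFn n X => F.1) (@nhds _ (VietorisTop _) G.1) :=
    @nhds_induced _ _ (VietorisTop _) _ _
  rw [h, ← tendsto_iff_comap]
  refine TopologicalSpace.tendsto_nhds_generateFrom_iff.2 ?_
  rintro s (⟨U, hU, -, rfl⟩ | ⟨U, hU, -, rfl⟩) hG
  · exact hsub U hU hG
  · exact hhit U hU hG

theorem isClopen_of_mem_hitAlgebra (h𝒜 : ∀ a ∈ 𝒜, IsClopen a) {b : Set (HypFn n X)}
    (hb : b ∈ hitAlgebra n 𝒜) : IsClopen b := by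
  induction hb with
  | base b hb =>
    obtain ⟨a, ha, rfl⟩ := hb
    refine ⟨⟨?_⟩, isOpen_hit (h𝒜 a ha).isOpen⟩
    rw [compl_hit]
    exact isOpen_subset (h𝒜 a ha).compl.isOpen
  | empty => exact isClopen_empty
  | compl a _ ih => exact ih.compl
  | union a b _ _ iha ihb => exact iha.union ihb

theorem eventually_lt_supOn (hX : IsLelek 𝒜 N) {a : Set X} (ha : a ∈ 𝒜) (G : HypFn n X) {t : ℝ}
    (ht : t < supOn N a G.1) : ∀ᶠ F in coarseNhds (hitAlgebra n 𝒜) G, t < supOn N a F.1 := by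
  rcases lt_or_ge t 0 with ht0 | ht0
  · exact .of_forall fun F => ht0.trans_le (supOn_nonneg hX.nonneg)
  obtain ⟨x, hxG, hxa, hxt⟩ := exists_of_lt_supOn ht0 ht
  obtain ⟨b, hb, hxb, hbt⟩ := (mem_coarseNhds hX.algebra).1 (hX.eventually_lt hxt)
  filter_upwards [mem_coarseNhds_of_mem (hit_mem (hX.algebra.inter_mem ha hb))
    ⟨x, hxG, hxa, hxb⟩] with F hF
  obtain ⟨y, hyF, hya, hyb⟩ := hF
  exact lt_of_lt_of_le (hbt hyb) (le_supOn F.2.2.1 hyF hya)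

theorem eventually_lt_weighted (hX : IsLelek 𝒜 N) (hA : ∀ k, A k ∈ 𝒜) (G : HypFn n X) (k : ℕ)
    (t : ℝ) (ht : t < (1 / 2 : ℝ) ^ k * supOn N (A k) G.1) :
    ∀ᶠ F in coarseNhds (hitAlgebra n 𝒜) G, t < (1 / 2 : ℝ) ^ k * supOn N (A k) F.1 := by
  have hk : (0 : ℝ) < (1 / 2) ^ k := by positivity
  rw [← div_lt_iff₀' hk] at ht
  filter_upwards [eventually_lt_supOn hX (hA k) G ht] with F hF
  rwa [← div_lt_iff₀' hk]

theorem eventually_lt_weightedSup (hX : IsLelek 𝒜 N) (hA : ∀ k, A k ∈ 𝒜) (G : HypFn n X) {t : ℝ}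
    (ht : t < weightedSup N A G.1) :
    ∀ᶠ F in coarseNhds (hitAlgebra n 𝒜) G, t < weightedSup N A F.1 := by
  have h := eventually_lt_tsum (l := coarseNhds (hitAlgebra n 𝒜) G) (t := t)
    (g := fun k (F : HypFn n X) => (1 / 2 : ℝ) ^ k * supOn N (A k) F.1)
    (G := fun k => (1 / 2 : ℝ) ^ k * supOn N (A k) G.1)
    (fun k F => weighted_supOn_nonneg hX.nonneg A k F.1)
    (fun F => summable_weightedSup hX.nonneg A F.2.2.1)
    (fun k => weighted_supOn_nonneg hX.nonneg A k G.1)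
    (summable_weightedSup hX.nonneg A G.2.2.1) (eventually_lt_weighted hX hA G)
  exact h ht

theorem tendsto_supOn_of_tendsto_weightedSup (hX : IsLelek 𝒜 N) (hA : ∀ k, A k ∈ 𝒜)
    {G : HypFn n X} {l : Filter (HypFn n X)} (hl : l ≤ coarseNhds (hitAlgebra n 𝒜) G)
    (hlim : Tendsto (fun F : HypFn n X => weightedSup N A F.1) l (𝓝 (weightedSup N A G.1)))
    (k : ℕ) : Tendsto (fun F : HypFn n X => supOn N (A k) F.1) l (𝓝 (supOn N (A k) G.1)) := by
  have h := tendsto_of_tendsto_tsum (fun k (F : HypFn n X) =>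
    weighted_supOn_nonneg hX.nonneg A k F.1) (fun F => summable_weightedSup hX.nonneg A F.2.2.1)
    (fun k => weighted_supOn_nonneg hX.nonneg A k G.1) (summable_weightedSup hX.nonneg A G.2.2.1)
    (fun k t ht => hl (eventually_lt_weighted hX hA G k t ht)) hlim k
  have h2 := h.const_mul ((2 : ℝ) ^ k)
  simpa only [← mul_assoc, ← mul_pow, mul_one_div_cancel (two_ne_zero (α := ℝ)), one_pow, one_mul]
    using h2

theorem isOpen_of_mem
    (hXt : ∀ x, 𝓝 x = coarseNhds 𝒜 x ⊓ comap N (𝓝 (N x)))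
    {a : Set X} (ha : a ∈ 𝒜) : IsOpen a :=
  isOpen_iff_mem_nhds.2 fun x hx => by
    rw [hXt]
    exact mem_inf_of_left (mem_coarseNhds_of_mem ha hx)

theorem continuous_of_nhds_eq
    (hXt : ∀ x, 𝓝 x = coarseNhds 𝒜 x ⊓ comap N (𝓝 (N x))) : Continuous N :=
  continuous_iff_continuousAt.2 fun x => by
    rw [ContinuousAt, hXt]
    exact tendsto_comap.mono_left inf_le_right

theorem nhds_le_coarseNhds
    (hXt : ∀ x, 𝓝 x = coarseNhds 𝒜 x ⊓ comap N (𝓝 (N x)))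
    (hX : IsLelek 𝒜 N) (G : HypFn n X) :
    𝓝 G ≤ coarseNhds (hitAlgebra n 𝒜) G := by
  refine le_iInf₂ fun b hb => le_principal_iff.2 ?_
  refine (isClopen_of_mem_hitAlgebra (fun a ha => ⟨⟨?_⟩, isOpen_of_mem hXt ha⟩)
    hb.1).isOpen.mem_nhds hb.2
  exact isOpen_of_mem hXt (hX.algebra.compl_mem ha)

theorem continuous_supOn
    (hXt : ∀ x, 𝓝 x = coarseNhds 𝒜 x ⊓ comap N (𝓝 (N x)))
    (hX : IsLelek 𝒜 N) {a : Set X} (ha : a ∈ 𝒜) :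
    Continuous fun F : HypFn n X => supOn N a F.1 := by
  refine continuous_iff_continuousAt.2 fun G => tendsto_order.2 ⟨fun t ht =>
    nhds_le_coarseNhds hXt hX G (eventually_lt_supOn hX ha G ht), fun t ht => ?_⟩
  have hopen : IsOpen (aᶜ ∪ {x | N x < t}) := (isOpen_of_mem hXt (hX.algebra.compl_mem ha)).union
    (isOpen_lt (continuous_of_nhds_eq hXt) continuous_const)
  have hG : G ∈ {F : HypFn n X | F.1 ⊆ aᶜ ∪ {x | N x < t}} := fun x hx => by
    by_cases hxa : x ∈ a
    · exact .inr ((le_supOn G.2.2.1 hx hxa).trans_lt ht)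
    · exact .inl hxa
  filter_upwards [(isOpen_subset hopen).mem_nhds hG] with F hF
  exact supOn_lt F.2.2.1 ((supOn_nonneg hX.nonneg).trans_lt ht) fun x hx hxa =>
    (hF hx).resolve_left (not_not.2 hxa)

theorem continuous_weightedSup
    (hXt : ∀ x, 𝓝 x = coarseNhds 𝒜 x ⊓ comap N (𝓝 (N x)))
    (hX : IsLelek 𝒜 N) (hA : ∀ k, A k ∈ 𝒜) :
    Continuous fun F : HypFn n X => weightedSup N A F.1 := by
  refine continuous_iff_continuousAt.2 fun G => ?_
  refine tendsto_tsum_of_dominated_convergence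
    (summable_geometric_two.mul_right (supOn N univ G.1 + 1))
    (fun k => ((continuous_supOn hXt hX (hA k)).continuousAt (x := G)).const_mul _) ?_
  filter_upwards [(tendsto_order.1 ((continuous_supOn hXt hX hX.algebra.univ_mem).continuousAt
    (x := G))).2 (supOn N univ G.1 + 1) (by linarith)] with F hF k
  rw [Real.norm_of_nonneg (weighted_supOn_nonneg hX.nonneg A k F.1)]
  exact mul_le_mul_of_nonneg_left ((supOn_le_univ hX.nonneg F.2.2.1).trans hF.le) (by positivity)

theorem exists_eventually_mem
    (hXt : ∀ x, 𝓝 x = coarseNhds 𝒜 x ⊓ comap N (𝓝 (N x)))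
    (hX : IsLelek 𝒜 N) (hA : 𝒜 = range A) {G : HypFn n X} {x : X}
    (hx : x ∈ G.1) {U : Set X} (hU : U ∈ 𝓝 x) : ∃ c ∈ 𝒜, x ∈ c ∧
      ∀ᶠ F in coarseNhds (hitAlgebra n 𝒜) G ⊓
        comap (fun F : HypFn n X => weightedSup N A F.1) (𝓝 (weightedSup N A G.1)),
        ∀ y ∈ F.1, y ∈ c → y ∈ U := by
  rw [hXt, mem_inf_iff] at hU
  obtain ⟨s, hs, t, ht, rfl⟩ := hU
  obtain ⟨v, hv, hvt⟩ := ht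
  obtain ⟨ε, hε, hεv⟩ := Metric.mem_nhds_iff.1 hv
  have hsep : ∀ᶠ y in coarseNhds 𝒜 x, ∀ z ∈ G.1 \ {x}, y ≠ z := by
    refine (Filter.eventually_all_finite (G.2.2.1.subset sdiff_subset)).2 fun z hz => ?_
    obtain ⟨a, ha, hxa, hza⟩ := hX.separates x z (Ne.symm hz.2)
    filter_upwards [mem_coarseNhds_of_mem ha hxa] with y hy
    rintro rfl
    exact hza hy
  obtain ⟨c, hc, hxc, hcs⟩ := (mem_coarseNhds hX.algebra).1
    ((hsep.and (hX.eventually_lt (sub_lt_self (N x) hε))).and hs)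
  have hsup : supOn N c G.1 = N x := by
    refine le_antisymm (supOn_le (hX.nonneg x) fun z hz hzc => ?_) (le_supOn G.2.2.1 hx hxc)
    by_cases hzx : z = x
    · rw [hzx]
    · exact absurd rfl ((hcs hzc).1.1 z ⟨hz, hzx⟩)
  obtain ⟨k, rfl⟩ := hA ▸ hc
  refine ⟨A k, hc, hxc, ?_⟩
  have hlim := tendsto_supOn_of_tendsto_weightedSup hX (fun k => hA ▸ mem_range_self k)
    (inf_le_left : coarseNhds (hitAlgebra n 𝒜) G ⊓ _ ≤ _)
    (tendsto_comap.mono_left inf_le_right) k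
  rw [hsup] at hlim
  filter_upwards [(tendsto_order.1 hlim).2 (N x + ε) (by linarith)] with F hF y hyF hyc
  refine ⟨(hcs hyc).2, hvt (hεv ?_)⟩
  rw [Metric.mem_ball, Real.dist_eq, abs_lt]
  have h1 : N x - ε < N y := (hcs hyc).1.2
  have h2 := le_supOn (N := N) F.2.2.1 hyF hyc
  constructor <;> linarith

theorem nhds_eq
    (hXt : ∀ x, 𝓝 x = coarseNhds 𝒜 x ⊓ comap N (𝓝 (N x)))
    (hX : IsLelek 𝒜 N) (hA : 𝒜 = range A) (G : HypFn n X) :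
    𝓝 G = coarseNhds (hitAlgebra n 𝒜) G ⊓
      comap (fun F : HypFn n X => weightedSup N A F.1) (𝓝 (weightedSup N A G.1)) := by
  refine le_antisymm (le_inf (nhds_le_coarseNhds hXt hX G) ?_) (le_nhds ?_ ?_)
  · exact tendsto_iff_comap.1
      (continuous_weightedSup hXt hX fun k => hA ▸ mem_range_self k).continuousAt
  · intro U hU hGU
    choose! c hc hxc hcU using fun x (hx : x ∈ G.1) =>
      exists_eventually_mem hXt hX hA hx (hU.mem_nhds (hGU hx))
    have hcover : ∀ᶠ F in coarseNhds (hitAlgebra n 𝒜) G, F.1 ⊆ ⋃ x ∈ G.1, c x := by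
      have hmem : ⋃ x ∈ G.1, c x ∈ 𝒜 := by
        have := hX.algebra.biUnion_mem (s := c) G.2.2.1.toFinset fun x hx => hc x (by simpa using hx)
        simpa using this
      have h := mem_coarseNhds_of_mem (x := G) (isSetAlgebra_hitAlgebra.compl_mem
        (hit_mem (n := n) (hX.algebra.compl_mem hmem))) (by
          rw [compl_hit, compl_compl]
          exact fun x hx => mem_biUnion hx (hxc x hx))
      rwa [compl_hit, compl_compl] at h
    filter_upwards [mem_inf_of_left hcover, (Filter.eventually_all_finite G.2.2.1).2 hcU]
      with F hF hFU y hy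
    obtain ⟨x, hx, hyx⟩ := mem_iUnion₂.1 (hF hy)
    exact hFU x hx y hy hyx
  · rintro U hU ⟨x, hx, hxU⟩
    obtain ⟨c, hc, hxc, hcU⟩ := exists_eventually_mem hXt hX hA hx (hU.mem_nhds hxU)
    filter_upwards [mem_inf_of_left (mem_coarseNhds_of_mem (hit_mem hc) ⟨x, hx, hxc⟩), hcU]
      with F hF hFU
    obtain ⟨y, hy, hyc⟩ := hF
    exact ⟨y, hy, hFU y hy hyc⟩

theorem exists_separating (hX : IsLelek 𝒜 N) {F G : HypFn n X} (hFG : F ≠ G) :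
    ∃ b ∈ hitAlgebra n 𝒜, F ∈ b ∧ G ∉ b := by
  have key : ∀ F G : HypFn n X, ∀ x ∈ F.1, x ∉ G.1 →
      ∃ a ∈ 𝒜, F ∈ hit n a ∧ G ∉ hit n a := fun F G x hxF hxG => by
    have hev : ∀ᶠ y in coarseNhds 𝒜 x, ∀ z ∈ G.1, y ≠ z := by
      refine (Filter.eventually_all_finite G.2.2.1).2 fun z hz => ?_
      obtain ⟨a, ha, hxa, hza⟩ := hX.separates x z (by rintro rfl; exact hxG hz)
      filter_upwards [mem_coarseNhds_of_mem ha hxa] with y hy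
      rintro rfl
      exact hza hy
    obtain ⟨a, ha, hxa, haG⟩ := (mem_coarseNhds hX.algebra).1 hev
    refine ⟨a, ha, ⟨x, hxF, hxa⟩, ?_⟩
    rintro ⟨z, hzG, hza⟩
    exact haG hza z hzG rfl
  by_cases hsub : F.1 ⊆ G.1
  · obtain ⟨x, hxG, hxF⟩ := not_subset.1 fun h => hFG (Subtype.ext (hsub.antisymm h))
    obtain ⟨a, ha, hG, hF⟩ := key G F x hxG hxF
    exact ⟨_, isSetAlgebra_hitAlgebra.compl_mem (hit_mem ha), hF, not_not.2 hG⟩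
  · obtain ⟨x, hxF, hxG⟩ := not_subset.1 hsub
    obtain ⟨a, ha, hF, hG⟩ := key F G x hxF hxG
    exact ⟨_, hit_mem ha, hF, hG⟩

theorem exists_range_eq (F : HypFn n X) : ∃ e : Fin n → X, range e = F.1 := by
  have := F.2.2.1.fintype
  have := F.2.1.to_subtype
  have hcard : Fintype.card F.1 ≤ Fintype.card (Fin n) := by
    rw [Fintype.card_fin, ← Nat.card_eq_fintype_card]
    exact F.2.2.2
  obtain ⟨f⟩ := Function.Embedding.nonempty_of_card_le hcard
  refine ⟨fun i => (Function.invFun f i).1, ?_⟩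
  rw [range_comp' Subtype.val, (Function.invFun_surjective f.injective).range_eq, image_univ,
    Subtype.range_coe]

theorem exists_limit (hn : 1 ≤ n) (hX : IsLelek 𝒜 N) (hA : 𝒜 = range A) (hA0 : A 0 = univ)
    (U : Ultrafilter (HypFn n X))
    (hU : ∃ r, ∀ᶠ F in (U : Filter (HypFn n X)), weightedSup N A F.1 ≤ r) :
    ∃ G : HypFn n X, (∀ b ∈ hitAlgebra n 𝒜, G ∈ b → b ∈ U) ∧
      ∀ r, (∀ᶠ F in (U : Filter (HypFn n X)), weightedSup N A F.1 ≤ r) →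
        weightedSup N A G.1 ≤ r := by
  choose e he using exists_range_eq (X := X) (n := n)
  obtain ⟨r, hr⟩ := hU
  choose z hz _ using fun i => hX.compact (U.map fun F => e F i) ⟨r, by
    rw [Ultrafilter.coe_map, eventually_map]
    filter_upwards [hr] with F hF
    exact (le_weightedSup hX.nonneg hA0 F.2.2.1 (he F ▸ mem_range_self i)).trans hF⟩
  have hz' : ∀ i, ∀ a ∈ 𝒜, z i ∈ a ↔ ∀ᶠ F in (U : Filter (HypFn n X)), e F i ∈ a :=
    fun i a ha => by
    refine ⟨hz i a ha, fun h => ?_⟩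
    by_contra hza
    exact Ultrafilter.compl_mem_iff_notMem.1 (hz i _ (hX.algebra.compl_mem ha) hza) h
  have hcard : (range z).ncard ≤ n := by
    rw [← image_univ]
    refine (ncard_image_le finite_univ).trans ?_
    simp [ncard_univ]
  let G : HypFn n X := ⟨range z, ⟨z ⟨0, hn⟩, mem_range_self _⟩, finite_range z, hcard⟩
  have hG : ∀ b ∈ hitAlgebra n 𝒜, G ∈ b ↔ b ∈ U := fun b hb => by
    induction hb with
    | base b hb =>
      obtain ⟨a, ha, rfl⟩ := hb
      have h1 : G ∈ hit n a ↔ ∃ i, z i ∈ a := by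
        constructor
        · rintro ⟨_, ⟨i, rfl⟩, hi⟩
          exact ⟨i, hi⟩
        · rintro ⟨i, hi⟩
          exact ⟨z i, mem_range_self i, hi⟩
      have h2 : hit n a = {F | ∃ i, e F i ∈ a} := by
        ext F
        constructor
        · rintro ⟨y, hy, hya⟩
          rw [← he F] at hy
          obtain ⟨i, rfl⟩ := hy
          exact ⟨i, hya⟩
        · rintro ⟨i, hi⟩
          exact ⟨e F i, he F ▸ mem_range_self i, hi⟩
      rw [h1, h2]
      simp only [hz' _ a ha]
      exact Ultrafilter.eventually_exists_iff.symm
    | empty => simp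
    | compl a _ ih => rw [mem_compl_iff, ih, Ultrafilter.compl_mem_iff_notMem]
    | union a b _ _ iha ihb => rw [mem_union, iha, ihb, Ultrafilter.union_mem_iff]
  refine ⟨G, fun b hb => (hG b hb).1, fun s hs => ?_⟩
  by_contra! hlt
  obtain ⟨b, hb, hGb, hbs⟩ := (mem_coarseNhds isSetAlgebra_hitAlgebra).1
    (eventually_lt_weightedSup hX (fun k => hA ▸ mem_range_self k) G hlt)
  obtain ⟨F, hFs, hFb⟩ := (hs.and ((hG b hb).1 hGb)).exists
  exact absurd (hbs hFb) (not_lt.2 hFs)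

/-- The member of the symmetric product obtained by replacing the point `x` by `y`. -/
def replace (F : HypFn n X) {x : X} (hx : x ∈ F.1) (y : X) : HypFn n X :=
  ⟨insert y (F.1 \ {x}), insert_nonempty _ _, (F.2.2.1.subset sdiff_subset).insert y, by
    refine (ncard_insert_le _ _).trans ?_
    rw [ncard_sdiff_singleton_add_one hx F.2.2.1]
    exact F.2.2.2⟩

theorem replace_self (F : HypFn n X) {x : X} (hx : x ∈ F.1) : F.replace hx x = F :=
  Subtype.ext (insert_sdiff_self_of_mem hx)

theorem eventually_replace_mem_iff (h𝒜 : IsSetAlgebra 𝒜) (F : HypFn n X) {x : X} (hx : x ∈ F.1)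
    {b : Set (HypFn n X)} (hb : b ∈ hitAlgebra n 𝒜) :
    ∀ᶠ y in coarseNhds 𝒜 x, (F.replace hx y ∈ b ↔ F.replace hx x ∈ b) := by
  induction hb with
  | base b hb =>
    obtain ⟨a, ha, rfl⟩ := hb
    filter_upwards [eventually_mem_iff_coarseNhds h𝒜 ha x] with y hy
    have h : ∀ z, F.replace hx z ∈ hit n a ↔ z ∈ a ∨ ((F.1 \ {x}) ∩ a).Nonempty := fun z => by
      constructor
      · rintro ⟨w, (rfl | hw), hwa⟩
        exacts [.inl hwa, .inr ⟨w, hw, hwa⟩]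
      · rintro (hz | ⟨w, hw, hwa⟩)
        exacts [⟨z, mem_insert _ _, hz⟩, ⟨w, mem_insert_of_mem _ hw, hwa⟩]
    rw [h, h, hy]
  | empty => simp
  | compl a _ ih => exact ih.mono fun y hy => not_congr hy
  | union a b _ _ iha ihb =>
    filter_upwards [iha, ihb] with y hya hyb using or_congr hya hyb

open Classical in
theorem exists_weightedSup_mem_Ioo (hX : IsLelek 𝒜 N) (hA : ∀ k, A k ∈ 𝒜) (hA0 : A 0 = univ)
    {b : Set (HypFn n X)} (hb : b ∈ hitAlgebra n 𝒜) {F : HypFn n X} (hF : F ∈ b) {r s : ℝ}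
    (hr : weightedSup N A F.1 ≤ r) (hrs : r < s) :
    ∃ G ∈ b, r < weightedSup N A G.1 ∧ weightedSup N A G.1 < s := by
  obtain ⟨x, hx⟩ := F.2.1
  set D := F.1 \ {x}
  have hD : D.Finite := F.2.2.1.subset sdiff_subset
  have hrep : ∀ y, weightedSup N A (F.replace hx y).1 =
      ∑' k, (1 / 2 : ℝ) ^ k * max (supOn N (A k) D) (if y ∈ A k then N y else 0) := fun y =>
    tsum_congr fun k => by rw [← supOn_insert hX.nonneg hD]; rfl
  let θ : ℝ → ℝ := fun v =>
    ∑' k, (1 / 2 : ℝ) ^ k * max (supOn N (A k) D) (if x ∈ A k then v else 0)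
  have hxs : N x ≤ s :=
    ((le_weightedSup hX.nonneg hA0 F.2.2.1 hx).trans hr).trans hrs.le
  have hs0 : 0 ≤ s := (hX.nonneg x).trans hxs
  have hnonneg : ∀ (k : ℕ) (c : ℝ), 0 ≤ max (supOn N (A k) D) c := fun k c =>
    le_max_of_le_left (supOn_nonneg hX.nonneg)
  have hbound : ∀ (k : ℕ) (p : Prop) [Decidable p] (v w : ℝ), 0 ≤ w → v ≤ w →
      ‖(1 / 2 : ℝ) ^ k * max (supOn N (A k) D) (if p then v else 0)‖ ≤
        (1 / 2 : ℝ) ^ k * (supOn N univ D + w) := fun k p _ v w hw hvw => by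
    rw [Real.norm_of_nonneg (mul_nonneg (by positivity) (hnonneg k _))]
    have h1 := supOn_le_univ (a := A k) hX.nonneg hD
    have h2 : 0 ≤ supOn N univ D := supOn_nonneg hX.nonneg
    refine mul_le_mul_of_nonneg_left (max_le (by linarith) ?_) (by positivity)
    split_ifs <;> linarith
  have hθcont : ContinuousOn θ (Icc (N x) s) := by
    refine continuousOn_tsum (fun k => ?_) (summable_geometric_two.mul_right (supOn N univ D + s))
      fun k v hv => hbound k _ v s hs0 hv.2
    split_ifs <;> fun_prop
  have hθx : θ (N x) ≤ r := by
    rw [← F.replace_self hx, hrep] at hr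
    exact hr
  have hθs : s ≤ θ s := by
    have hsum : Summable fun k =>
        (1 / 2 : ℝ) ^ k * max (supOn N (A k) D) (if x ∈ A k then s else 0) :=
      .of_norm_bounded (summable_geometric_two.mul_right (supOn N univ D + s))
        fun k => hbound k _ s s hs0 le_rfl
    have := hsum.le_tsum 0 fun k _ => mul_nonneg (by positivity) (hnonneg k _)
    rw [pow_zero, one_mul, hA0, if_pos (mem_univ x)] at this
    exact (le_max_right _ _).trans this
  obtain ⟨v, ⟨hxv, hvs⟩, hv⟩ := intermediate_value_Icc hxs hθcont
    (show (r + s) / 2 ∈ Icc (θ (N x)) (θ s) from ⟨by linarith, by linarith⟩)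
  have hNv : Tendsto N (coarseNhds 𝒜 x ⊓ comap N (𝓝 v)) (𝓝 v) :=
    tendsto_comap.mono_left inf_le_right
  have hlim : Tendsto (fun y => weightedSup N A (F.replace hx y).1)
      (coarseNhds 𝒜 x ⊓ comap N (𝓝 v)) (𝓝 (θ v)) := by
    simp only [hrep]
    refine tendsto_tsum_of_dominated_convergence
      (summable_geometric_two.mul_right (supOn N univ D + (v + 1))) (fun k => ?_) ?_
    · have hlim : Tendsto (fun y => (1 / 2 : ℝ) ^ k *
          max (supOn N (A k) D) (if x ∈ A k then N y else 0)) (coarseNhds 𝒜 x ⊓ comap N (𝓝 v))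
          (𝓝 ((1 / 2 : ℝ) ^ k * max (supOn N (A k) D) (if x ∈ A k then v else 0))) := by
        refine (tendsto_const_nhds.max ?_).const_mul _
        split_ifs
        · exact hNv
        · exact tendsto_const_nhds
      refine hlim.congr' ?_
      filter_upwards [(eventually_mem_iff_coarseNhds hX.algebra (hA k) x).filter_mono inf_le_left]
        with y hy
      simp only [hy]
    · filter_upwards [(tendsto_order.1 hNv).2 (v + 1) (by linarith)] with y hy k
      exact hbound k _ (N y) (v + 1) ((hX.nonneg y).trans hy.le) hy.le
  rw [hv] at hlim
  have := hX.neBot_coarseNhds_inf_comap hxv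
  obtain ⟨y, hyb, hy⟩ := (((eventually_replace_mem_iff hX.algebra F hx hb).filter_mono
    inf_le_left).and (hlim.eventually (Ioo_mem_nhds (show r < (r + s) / 2 by linarith)
      (show (r + s) / 2 < s by linarith)))).exists
  rw [replace_self] at hyb
  exact ⟨_, hyb.2 hF, hy⟩

/-- The symmetric products of a space with a Lelek structure carry a Lelek structure. -/
theorem isLelek (hn : 1 ≤ n) (hX : IsLelek 𝒜 N) (hA : 𝒜 = range A) (hA0 : A 0 = univ) :
    IsLelek (hitAlgebra n 𝒜) fun F => weightedSup N A F.1 where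
  countable := countable_generateSetAlgebra (hX.countable.image _)
  algebra := isSetAlgebra_hitAlgebra
  separates _ _ := exists_separating hX
  nonneg F := tsum_nonneg fun k => weighted_supOn_nonneg hX.nonneg A k F.1
  compact := exists_limit hn hX hA hA0
  dense _ hb _ hF _ _ hr hrs :=
    exists_weightedSup_mem_Ioo hX (fun k => hA ▸ mem_range_self k) hA0 hb hF hr hrs

end HypFn

theorem IsLelek.exists_enumeration {X : Type*} {𝒜 : Set (Set X)} {N : X → ℝ}
    (hX : IsLelek 𝒜 N) : ∃ A : ℕ → Set X, 𝒜 = range A ∧ A 0 = univ := by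
  obtain ⟨B, hB⟩ := hX.countable.exists_eq_range ⟨_, hX.algebra.empty_mem⟩
  refine ⟨fun k => Nat.casesOn k univ B, ?_, rfl⟩
  ext a
  constructor
  · intro ha
    obtain ⟨k, rfl⟩ := hB ▸ ha
    exact ⟨k + 1, rfl⟩
  · rintro ⟨_ | k, rfl⟩
    · exact hX.algebra.univ_mem
    · exact hB ▸ mem_range_self k

/-- For every `n ≥ 1`, the `n`-th symmetric product of complete Erdős space, with the
Vietoris topology, is homeomorphic to complete Erdős space. -/
theorem symmetricProduct_completeErdos_homeomorph (n : ℕ) (hn : 1 ≤ n) :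
    Nonempty (HypFn n CompleteErdosSpace ≃ₜ CompleteErdosSpace) := by
  obtain ⟨A, hA, hA0⟩ := CompleteErdosSpace.isLelek.exists_enumeration
  obtain ⟨x⟩ : Nonempty CompleteErdosSpace := inferInstance
  have : Nonempty (HypFn n CompleteErdosSpace) :=
    ⟨⟨{x}, singleton_nonempty x, finite_singleton x, by simpa using hn⟩⟩
  exact (HypFn.isLelek hn CompleteErdosSpace.isLelek hA hA0).nonempty_homeomorph
    (HypFn.nhds_eq CompleteErdosSpace.nhds_eq CompleteErdosSpace.isLelek hA)
    CompleteErdosSpace.isLelek CompleteErdosSpace.nhds_eq
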